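/- Let A ∈ ℂ^{n×n} and B ∈ ℂ^{m×m}. The Sylvester equation A X + X B = C has a unique solution X ∈ ℂ^{n×m} for every right-hand side C ∈ ℂ^{n×m} (equivalently, the linear map X ↦ A X + X B on ℂ^{n×m} is bijective) if and only if the spectra of A and −B are disjoint, i.e., spectrum(A) ∩ spectrum(−B) = ∅. -/

import Mathlib

theorem Matrix.aeval_mul_eq_mul_aeval {R ι κ : Type*} [CommRing R] [Fintype ι] [DecidableEq ι]
    [Fintype κ] [DecidableEq κ] {A : Matrix ι ι R} {B : Matrix κ κ R} {X : Matrix ι κ R}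
    (h : A * X = X * B) (p : Polynomial R) :
    Polynomial.aeval A p * X = X * Polynomial.aeval B p := by
  induction p using Polynomial.induction_on' with
  | add p q hp hq => simp only [map_add, Matrix.add_mul, Matrix.mul_add, hp, hq]
  | monomial k a =>
    have hk : A ^ k * X = X * B ^ k := by
      induction k with
      | zero => simp
      | succ k ih => rw [pow_succ, Matrix.mul_assoc, h, ← Matrix.mul_assoc, ih, Matrix.mul_assoc,
          ← pow_succ]
    simp [Polynomial.aeval_monomial, Algebra.algebraMap_eq_smul_one, hk]

theorem Matrix.eq_zero_of_mul_eq_mul_of_disjoint_spectrum {K ι κ : Type*} [Field K]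
    [IsAlgClosed K] [Fintype ι] [DecidableEq ι] [Fintype κ] [DecidableEq κ]
    {A : Matrix ι ι K} {B : Matrix κ κ K} (hAB : Disjoint (spectrum K A) (spectrum K B))
    {X : Matrix ι κ K} (h : A * X = X * B) : X = 0 := by
  have hcop : IsCoprime A.charpoly B.charpoly := by
    refine (Polynomial.isCoprime_iff_aeval_ne_zero_of_isAlgClosed K K _ _).2 fun μ ↦ ?_
    by_contra! hμ
    simp only [Polynomial.coe_aeval_eq_eval] at hμ
    exact Set.disjoint_left.1 hAB (Matrix.mem_spectrum_iff_isRoot_charpoly.2 hμ.1)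
      (Matrix.mem_spectrum_iff_isRoot_charpoly.2 hμ.2)
  obtain ⟨u, v, huv⟩ := hcop
  have hA : Polynomial.aeval A v * Polynomial.aeval A B.charpoly = 1 := by
    simpa [Matrix.aeval_self_charpoly] using congrArg (Polynomial.aeval A) huv
  rw [← Matrix.one_mul X, ← hA, Matrix.mul_assoc, Matrix.aeval_mul_eq_mul_aeval h,
    Matrix.aeval_self_charpoly, Matrix.mul_zero, Matrix.mul_zero]

theorem Matrix.exists_ne_zero_mul_eq_mul_of_mem_spectrum {K ι κ : Type*} [Field K]
    [Fintype ι] [DecidableEq ι] [Fintype κ] [DecidableEq κ]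
    {A : Matrix ι ι K} {B : Matrix κ κ K} {μ : K} (hA : μ ∈ spectrum K A)
    (hB : μ ∈ spectrum K B) : ∃ X : Matrix ι κ K, X ≠ 0 ∧ A * X = X * B := by
  rw [spectrum.mem_iff, Matrix.isUnit_iff_isUnit_det, isUnit_iff_ne_zero, not_not] at hA hB
  obtain ⟨v, hv, hAv⟩ := Matrix.exists_mulVec_eq_zero_iff.2 hA
  obtain ⟨w, hw, hBw⟩ := Matrix.exists_vecMul_eq_zero_iff.2 hB
  rw [Matrix.sub_mulVec, sub_eq_zero, Algebra.algebraMap_eq_smul_one, Matrix.smul_mulVec,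
    Matrix.one_mulVec] at hAv
  rw [Matrix.vecMul_sub, sub_eq_zero, Algebra.algebraMap_eq_smul_one, Matrix.vecMul_smul,
    Matrix.vecMul_one] at hBw
  refine ⟨Matrix.vecMulVec v w, fun h ↦ ?_, ?_⟩
  · obtain ⟨i, hi⟩ := Function.ne_iff.1 hv
    obtain ⟨j, hj⟩ := Function.ne_iff.1 hw
    exact mul_ne_zero hi hj (congrFun₂ h i j)
  · rw [Matrix.mul_vecMulVec, Matrix.vecMulVec_mul, ← hAv, ← hBw, Matrix.smul_vecMulVec,
      Matrix.vecMulVec_smul]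


open Matrix
open scoped Kronecker

/-- The spectral norm (operator norm induced by the Euclidean vector norm). -/
noncomputable def specNorm {m n : Type*} [Fintype m] [Fintype n] [DecidableEq n]
    (A : Matrix m n ℝ) : ℝ :=
  ‖LinearMap.toContinuousLinearMap (Matrix.toEuclideanLin A)‖

/-- The Frobenius norm of a real matrix. -/
noncomputable def frobNorm {m n : Type*} [Fintype m] [Fintype n] (A : Matrix m n ℝ) : ℝ :=
  Real.sqrt (∑ i, ∑ j, (A i j) ^ 2)

/-- The Euclidean norm of a (finitely indexed) real vector. -/
noncomputable def euclNorm {n : Type*} [Fintype n] (v : n → ℝ) : ℝ :=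
  Real.sqrt (∑ i, (v i) ^ 2)

/-- `P` is a selection matrix: its columns are distinct standard basis vectors. -/
def IsSelection {n p : ℕ} (P : Matrix (Fin n) (Fin p) ℝ) : Prop :=
  ∃ ρ : Fin p → Fin n, Function.Injective ρ ∧ ∀ i j, P i j = if i = ρ j then 1 else 0
/-- The Sylvester equation `A X + X B = C` has a unique solution `X` for every
right-hand side `C` if and only if the spectra of `A` and `−B` are disjoint. -/
theorem sylvester_unique_solution_iff_spectra_disjoint {n m : ℕ}
    (A : Matrix (Fin n) (Fin n) ℂ) (B : Matrix (Fin m) (Fin m) ℂ) :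
    (∀ C : Matrix (Fin n) (Fin m) ℂ,
        ∃! X : Matrix (Fin n) (Fin m) ℂ, A * X + X * B = C) ↔
      spectrum ℂ A ∩ spectrum ℂ (-B) = ∅ := by
  constructor
  · intro h
    refine Set.eq_empty_iff_forall_notMem.2 fun μ ⟨hA, hB⟩ ↦ ?_
    obtain ⟨X, hX, hAX⟩ := Matrix.exists_ne_zero_mul_eq_mul_of_mem_spectrum hA hB
    exact hX ((h 0).unique (by simp [hAX]) (by simp))
  · intro h
    let L : Matrix (Fin n) (Fin m) ℂ →ₗ[ℂ] Matrix (Fin n) (Fin m) ℂ :=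
      { toFun X := A * X + X * B
        map_add' X Y := by simp only [Matrix.mul_add, Matrix.add_mul]; abel
        map_smul' c X := by simp }
    have hL : Function.Injective L := (injective_iff_map_eq_zero L).2 fun X hX ↦
      Matrix.eq_zero_of_mul_eq_mul_of_disjoint_spectrum (Set.disjoint_iff_inter_eq_empty.2 h)
        (by rw [Matrix.mul_neg]; exact eq_neg_of_add_eq_zero_left hX)
    exact Function.Bijective.existsUnique ⟨hL, LinearMap.injective_iff_surjective.1 hL⟩
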